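/- arXiv:1603.05372 — 12 statements merged into one kernel-verified Lean document; each statement's English description precedes it below -/
import Mathlib

section
/- Let c > 0 and let U₀ = (ρ₀,q₀), U₋ = (ρ₋,q₋), U₊ = (ρ₊,q₊), U₁ = (ρ₁,q₁) be states in Ω. Suppose A > 0 satisfies the subcharacteristic condition for the pair (U₀,U₋) and for the pair (U₊,U₁). If g_A(U₀,U₋) = f(U₀) and g_A(U₊,U₁) = f(U₁) (as equalities in ℝ²), then U₀ = U₋ and U₁ = U₊. -/
open Real Set

/-- Flux of the isothermal Euler system: `f(ρ,q) = (q, q²/ρ + c²ρ)`. -/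
noncomputable def flux (c : ℝ) (U : ℝ × ℝ) : ℝ × ℝ :=
  (U.2, U.2 ^ 2 / U.1 + c ^ 2 * U.1)

/-- Rusanov numerical flux with speed `A`. -/
noncomputable def rus (c A : ℝ) (UL UR : ℝ × ℝ) : ℝ × ℝ :=
  (1 / 2 : ℝ) • (flux c UL + flux c UR) - (A / 2) • (UR - UL)

/-- Middle state of the Rusanov approximate Riemann solver. -/
noncomputable def mid (c A : ℝ) (UL UR : ℝ × ℝ) : ℝ × ℝ :=
  (1 / 2 : ℝ) • (UL + UR) - (1 / (2 * A)) • (flux c UR - flux c UL)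

/-- Entropy `E(ρ,q) = q²/(2ρ) + c²ρ log ρ`. -/
noncomputable def ent (c : ℝ) (U : ℝ × ℝ) : ℝ :=
  U.2 ^ 2 / (2 * U.1) + c ^ 2 * U.1 * Real.log U.1

/-- Entropy flux `F(ρ,q) = (q/ρ)(E(ρ,q) + c²ρ)`. -/
noncomputable def entFlux (c : ℝ) (U : ℝ × ℝ) : ℝ :=
  U.2 / U.1 * (ent c U + c ^ 2 * U.1)

/-- Momentum flux (charge) `η(ρ,q) = q²/ρ + c²ρ`. -/
noncomputable def eta (c : ℝ) (U : ℝ × ℝ) : ℝ := U.2 ^ 2 / U.1 + c ^ 2 * U.1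

/-- Numerical entropy flux of the Rusanov scheme. -/
noncomputable def numEntFlux (c A : ℝ) (V W : ℝ × ℝ) : ℝ :=
  (entFlux c V + entFlux c W) / 2 - A / 2 * (ent c W - ent c V)

/-- The state space `Ω = {(ρ,q) : ρ > 0}`. -/
def Omega : Set (ℝ × ℝ) := {U | 0 < U.1}

/-- Subcharacteristic condition for the pair `(UL, UR)`:
the middle state has positive density and
`A ≥ max(|q_L|/ρ_L, |q_R|/ρ_R, |q_*|/ρ_*) + c`. -/
def subchar (c A : ℝ) (UL UR : ℝ × ℝ) : Prop :=
  0 < (mid c A UL UR).1 ∧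
    max (|UL.2| / UL.1) (max (|UR.2| / UR.1)
      (|(mid c A UL UR).2| / (mid c A UL UR).1)) + c ≤ A

/-- Relative velocities on the same sonic or supersonic side of an isothermal shock, with equal mass
and momentum fluxes, coincide. -/
theorem relVelocity_eq_of_fluxes_eq {c r t a b : ℝ} (hc : 0 < c) (hr : 0 < r)
    (hab : c ≤ a ∧ c ≤ b ∨ a ≤ -c ∧ b ≤ -c)
    (hmass : r * a = t * b) (hmom : r * (a ^ 2 + c ^ 2) = t * (b ^ 2 + c ^ 2)) : a = b := by
  have key : (a - b) * (a * b - c ^ 2) = 0 := by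
    refine (mul_eq_zero.mp (?_ : r * ((a - b) * (a * b - c ^ 2)) = 0)).resolve_left hr.ne'
    linear_combination b * hmom - (b ^ 2 + c ^ 2) * hmass
  rcases mul_eq_zero.mp key with h | h
  · exact sub_eq_zero.mp h
  · rcases hab with ⟨ha, hb⟩ | ⟨ha, hb⟩ <;> nlinarith

/-- A discontinuity of speed `s` satisfying the Rankine-Hugoniot relations, with both states on the
same sonic or supersonic side relative to it, is trivial. -/
theorem eq_of_rankineHugoniot {c s : ℝ} {U V : ℝ × ℝ} (hc : 0 < c) (hU : U ∈ Omega)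
    (hV : V ∈ Omega) (hs : c ≤ U.2 / U.1 - s ∧ c ≤ V.2 / V.1 - s ∨
      U.2 / U.1 - s ≤ -c ∧ V.2 / V.1 - s ≤ -c)
    (h : flux c V - flux c U = s • (V - U)) : U = V := by
  obtain ⟨r, q⟩ := U
  obtain ⟨t, p⟩ := V
  simp only [Omega, mem_ofPred_eq] at hU hV
  simp only [flux, Prod.mk_sub_mk, Prod.smul_mk, smul_eq_mul, Prod.mk.injEq] at h hs
  obtain ⟨h₁, h₂⟩ := h
  obtain ⟨u, rfl⟩ : ∃ u, q = r * u := ⟨q / r, by field_simp⟩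
  obtain ⟨v, rfl⟩ : ∃ v, p = t * v := ⟨p / t, by field_simp⟩
  have hu : r * u / r = u := by field_simp
  have hv : t * v / t = v := by field_simp
  have hu2 : (r * u) ^ 2 / r = r * u ^ 2 := by field_simp
  have hv2 : (t * v) ^ 2 / t = t * v ^ 2 := by field_simp
  rw [hu, hv] at hs
  rw [hu2, hv2] at h₂
  have hmass : r * (u - s) = t * (v - s) := by linear_combination -h₁
  have huv : u - s = v - s := relVelocity_eq_of_fluxes_eq hc hU hs hmass
    (by linear_combination -h₂ + s * h₁)
  have hne : v - s ≠ 0 := by rcases hs with hs | hs <;> intro h0 <;> linarith [hs.2]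
  rw [huv] at hmass
  rw [mul_right_cancel₀ hne hmass, sub_left_injective huv]

/-- Both velocities are bounded by `A - c` under the subcharacteristic condition. -/
theorem subchar.abs_velocity_le {c A : ℝ} {UL UR : ℝ × ℝ} (h : subchar c A UL UR)
    (hL : UL ∈ Omega) (hR : UR ∈ Omega) :
    |UL.2 / UL.1| ≤ A - c ∧ |UR.2 / UR.1| ≤ A - c := by
  rw [abs_div, abs_div, abs_of_pos (show 0 < UL.1 from hL), abs_of_pos (show 0 < UR.1 from hR)]
  have h' := le_sub_iff_add_le.mpr h.2
  exact ⟨(le_max_left _ _).trans h',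
    ((le_max_left _ _).trans (le_max_right _ _)).trans h'⟩

/-- If `A` satisfies the subcharacteristic condition for `(U₀,U₋)` and
`(U₊,U₁)` and `g_A(U₀,U₋) = f(U₀)`, `g_A(U₊,U₁) = f(U₁)`, then `U₀ = U₋` and `U₁ = U₊`. -/
theorem stmt0 (c A : ℝ) (hc : 0 < c) (hA : 0 < A)
    (U0 Um Up U1 : ℝ × ℝ)
    (hU0 : U0 ∈ Omega) (hUm : Um ∈ Omega) (hUp : Up ∈ Omega) (hU1 : U1 ∈ Omega)
    (hsub1 : subchar c A U0 Um) (hsub2 : subchar c A Up U1)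
    (h1 : rus c A U0 Um = flux c U0) (h2 : rus c A Up U1 = flux c U1) :
    U0 = Um ∧ U1 = Up := by
  obtain ⟨h0, hm⟩ := hsub1.abs_velocity_le hU0 hUm
  obtain ⟨hp, h1'⟩ := hsub2.abs_velocity_le hUp hU1
  rw [abs_le] at h0 hm hp h1'
  constructor
  · refine eq_of_rankineHugoniot (s := A) hc hU0 hUm (Or.inr ⟨?_, ?_⟩) ?_
    · linarith
    · linarith
    · unfold rus at h1
      linear_combination (norm := module) (2 : ℝ) • h1
  · refine eq_of_rankineHugoniot (s := -A) hc hU1 hUp (Or.inl ⟨?_, ?_⟩) ?_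
    · linarith
    · linarith
    · unfold rus at h2
      linear_combination (norm := module) (2 : ℝ) • h2
end

section
/- Let c > 0, let U_L, U_R ∈ Ω, and suppose A > 0 satisfies the subcharacteristic condition for the pair (U_L,U_R), so that in particular the middle state U_* = U_*(U_L,U_R) lies in Ω. Then F(U_R) − F(U_L) ≤ A·(E(U_R) + E(U_L) − 2E(U_*)), with equality if and only if U_L = U_R. -/
open Real Set

theorem log_lt_sub_inv_div_two {y : ℝ} (hy : 1 < y) : Real.log y < (y - y⁻¹) / 2 := by
  rw [← Real.sinh_log (by linarith)]
  exact Real.self_lt_sinh_iff.2 (Real.log_pos hy)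

/-- The logarithm bound behind the positivity of `relEnt`, after minimizing over the densities. -/
theorem sq_mul_log_div_lt {a b c : ℝ} (hc : 0 < c) (ha : c ≤ a) (hb : c ≤ b) (hab : a ≠ b) :
    c ^ 2 * (a * Real.log (a / b)) < a * (a - b) ^ 2 / 2 + c ^ 2 * (a - b) := by
  have ha0 : 0 < a := hc.trans_le ha
  have hb0 : 0 < b := hc.trans_le hb
  have hcc : 0 < c ^ 2 := by positivity
  rcases lt_or_gt_of_ne hab with h | h
  · have hlog := Real.le_log_one_add_of_nonneg (x := b / a - 1)
      (by rw [sub_nonneg, one_le_div ha0]; exact h.le)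
    have hinv : Real.log (a / b) = -Real.log (1 + (b / a - 1)) := by
      rw [← Real.log_inv]; congr 1; field_simp; ring
    have heq : a * (2 * (b / a - 1) / (b / a - 1 + 2)) = 2 * a * (b - a) / (a + b) := by
      field_simp; ring
    have hle : a * Real.log (a / b) ≤ -(2 * a * (b - a) / (a + b)) := by
      rw [hinv, ← heq]
      nlinarith [mul_le_mul_of_nonneg_left hlog ha0.le]
    have hrat : -(2 * a * (b - a) / (a + b)) - (a - b) = (b - a) ^ 2 / (a + b) := by
      field_simp; ring
    have hbound : c ^ 2 * ((b - a) ^ 2 / (a + b)) < a * (a - b) ^ 2 / 2 := by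
      rw [← mul_div_assoc, div_lt_div_iff₀ (by positivity) two_pos]
      have h1 : c ^ 2 * 2 < a * (a + b) := by nlinarith
      have h2 : 0 < (b - a) ^ 2 := by have := sub_pos.2 h; positivity
      nlinarith [mul_lt_mul_of_pos_right h1 h2]
    nlinarith [mul_le_mul_of_nonneg_left hle hcc.le]
  · have hlog := log_lt_sub_inv_div_two ((one_lt_div hb0).2 h)
    have hbound : c ^ 2 * (a * ((a / b - (a / b)⁻¹) / 2) - (a - b)) ≤ a * (a - b) ^ 2 / 2 := by
      have heq : a * ((a / b - (a / b)⁻¹) / 2) - (a - b) = (a - b) ^ 2 / (2 * b) := by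
        field_simp; ring
      rw [heq, ← mul_div_assoc, div_le_div_iff₀ (by positivity) two_pos]
      have h1 : c ^ 2 ≤ a * b := by nlinarith
      nlinarith [mul_le_mul_of_nonneg_right h1 (sq_nonneg (a - b))]
    nlinarith [mul_lt_mul_of_pos_left (mul_lt_mul_of_pos_left hlog ha0) hcc]

/-- For `a = A ± u` and `b = A ± v`, this is the combination `A E(U|V) ± F(U|V)` of the relative
entropy and the relative entropy flux of the states `U = (r, r u)` and `V = (s, s v)`. -/
noncomputable def relEnt (c a b r s : ℝ) : ℝ :=
  a * r * ((a - b) ^ 2 / 2 + c ^ 2 * (Real.log r - Real.log s)) - c ^ 2 * b * (r - s)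

theorem relEnt_self (c a r : ℝ) : relEnt c a a r r = 0 := by
  simp [relEnt]

theorem relEnt_pos {a b c r s : ℝ} (hc : 0 < c) (ha : c ≤ a) (hb : c ≤ b) (hr : 0 < r)
    (hs : 0 < s) (h : ¬(a = b ∧ r = s)) : 0 < relEnt c a b r s := by
  have ha0 : 0 < a := hc.trans_le ha
  have hb0 : 0 < b := hc.trans_le hb
  have hcc : 0 < c ^ 2 := by positivity
  have hx : 0 < s * b / (r * a) := by positivity
  have hlogx : Real.log (s * b / (r * a)) =
      Real.log s + Real.log b - (Real.log r + Real.log a) := by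
    rw [Real.log_div (by positivity) (by positivity), Real.log_mul hs.ne' hb0.ne',
      Real.log_mul hr.ne' ha0.ne']
  have hscale : r * a * (s * b / (r * a) - 1) = s * b - r * a := by
    field_simp
  have hk : 0 < c ^ 2 * (r * a) := by positivity
  unfold relEnt
  by_cases hab : a = b
  · subst hab
    have hrs : s * a / (r * a) ≠ 1 := by
      intro h1
      rw [div_eq_one_iff_eq (by positivity)] at h1
      exact h ⟨rfl, (mul_right_cancel₀ ha0.ne' h1).symm⟩
    have hlog := mul_lt_mul_of_pos_left (Real.log_lt_sub_one_of_pos hx hrs) hk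
    rw [mul_assoc (c ^ 2) (r * a) (_ - 1), hscale, hlogx] at hlog
    linarith
  · have hlog := mul_le_mul_of_nonneg_left (Real.log_le_sub_one_of_pos hx) hk.le
    rw [mul_assoc (c ^ 2) (r * a) (_ - 1), hscale, hlogx] at hlog
    have hdiss := mul_lt_mul_of_pos_left (sq_mul_log_div_lt hc ha hb hab) hr
    rw [Real.log_div ha0.ne' hb0.ne'] at hdiss
    linarith

theorem relEnt_nonneg {a b c r s : ℝ} (hc : 0 < c) (ha : c ≤ a) (hb : c ≤ b) (hr : 0 < r)
    (hs : 0 < s) : 0 ≤ relEnt c a b r s := by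
  by_cases h : a = b ∧ r = s
  · rw [h.1, h.2, relEnt_self]
  · exact (relEnt_pos hc ha hb hr hs h).le

theorem ent_mul (c : ℝ) {r : ℝ} (hr : r ≠ 0) (u : ℝ) :
    ent c (r, r * u) = r * u ^ 2 / 2 + c ^ 2 * r * Real.log r := by
  simp only [ent]; field_simp

theorem entFlux_mul (c : ℝ) {r : ℝ} (hr : r ≠ 0) (u : ℝ) :
    entFlux c (r, r * u) = u * (r * u ^ 2 / 2 + c ^ 2 * r * Real.log r + c ^ 2 * r) := by
  simp only [entFlux, ent_mul c hr]; field_simp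

theorem flux_mul (c r u : ℝ) :
    flux c (r, r * u) = (r * u, r * u ^ 2 + c ^ 2 * r) := by
  simp only [flux]; field_simp

theorem two_mul_mid_fst {A : ℝ} (hA : A ≠ 0) (c : ℝ) (V W : ℝ × ℝ) :
    2 * A * (mid c A V W).1 = A * (V.1 + W.1) - ((flux c W).1 - (flux c V).1) := by
  simp [mid]; field_simp

theorem two_mul_mid_snd {A : ℝ} (hA : A ≠ 0) (c : ℝ) (V W : ℝ × ℝ) :
    2 * A * (mid c A V W).2 = A * (V.2 + W.2) - ((flux c W).2 - (flux c V).2) := by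
  simp [mid]; field_simp

theorem mid_self (c A : ℝ) (U : ℝ × ℝ) : mid c A U U = U := by
  ext <;> simp [mid] <;> ring

/-- The entropy dissipation of the middle state splits into two relative entropies. -/
theorem ent_dissipation_eq {A c r s m : ℝ} (hA : A ≠ 0) (hr : r ≠ 0) (hs : s ≠ 0) (hm : m ≠ 0)
    {u v w : ℝ} (hmid : mid c A (r, r * u) (s, s * v) = (m, m * w)) :
    A * (ent c (s, s * v) + ent c (r, r * u) - 2 * ent c (m, m * w)) -
      (entFlux c (s, s * v) - entFlux c (r, r * u)) =
    relEnt c (A + u) (A + w) r m + relEnt c (A - v) (A - w) s m := by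
  have h1 := two_mul_mid_fst hA c (r, r * u) (s, s * v)
  have h2 := two_mul_mid_snd hA c (r, r * u) (s, s * v)
  simp only [hmid, flux_mul] at h1 h2
  simp only [ent_mul c hr, ent_mul c hs, ent_mul c hm, entFlux_mul c hr, entFlux_mul c hs, relEnt]
  linear_combination (w ^ 2 / 2 - c ^ 2 * (Real.log m + 1)) * h1 - w * h2

/-- entropy inequality for the Rusanov middle state, with equality iff `U_L = U_R`. -/
theorem stmt1 (c A : ℝ) (hc : 0 < c) (hA : 0 < A)
    (UL UR : ℝ × ℝ) (hUL : UL ∈ Omega) (hUR : UR ∈ Omega)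
    (hsub : subchar c A UL UR) :
    entFlux c UR - entFlux c UL ≤
      A * (ent c UR + ent c UL - 2 * ent c (mid c A UL UR)) ∧
    (entFlux c UR - entFlux c UL =
      A * (ent c UR + ent c UL - 2 * ent c (mid c A UL UR)) ↔ UL = UR) := by
  obtain ⟨r, q⟩ := UL
  obtain ⟨s, p⟩ := UR
  have hr : 0 < r := hUL
  have hs : 0 < s := hUR
  obtain ⟨u, rfl⟩ : ∃ u, q = r * u := ⟨q / r, by field_simp⟩
  obtain ⟨v, rfl⟩ : ∃ v, p = s * v := ⟨p / s, by field_simp⟩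
  obtain ⟨hm, hmax⟩ := hsub
  obtain ⟨m, w, hmid⟩ : ∃ m w, mid c A (r, r * u) (s, s * v) = (m, m * w) :=
    ⟨_, (mid c A (r, r * u) (s, s * v)).2 / (mid c A (r, r * u) (s, s * v)).1,
      Prod.ext rfl (mul_div_cancel₀ _ hm.ne').symm⟩
  rw [hmid] at hm hmax
  have hspeed : ∀ {x : ℝ} (y : ℝ), 0 < x → |x * y| / x = |y| := fun y hx => by
    rw [abs_mul, abs_of_pos hx, mul_div_cancel_left₀ _ hx.ne']
  simp only [hspeed _ hr, hspeed _ hs, hspeed _ hm, ← le_sub_iff_add_le, max_le_iff,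
    abs_le] at hmax
  obtain ⟨⟨hu, -⟩, ⟨-, hv⟩, hw, hw'⟩ := hmax
  have hdiss := ent_dissipation_eq hA.ne' hr.ne' hs.ne' hm.ne' hmid
  have hL : c ≤ A + u := by linarith
  have hR : c ≤ A - v := by linarith
  have hML : c ≤ A + w := by linarith
  have hMR : c ≤ A - w := by linarith
  have hposL := relEnt_nonneg hc hL hML hr hm
  have hposR := relEnt_nonneg hc hR hMR hs hm
  rw [hmid]
  refine ⟨by linarith, fun heq => ?_, fun heq => ?_⟩
  · have hl : A + u = A + w ∧ r = m := by
      by_contra h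
      linarith [relEnt_pos hc hL hML hr hm h]
    have hr' : A - v = A - w ∧ s = m := by
      by_contra h
      linarith [relEnt_pos hc hR hMR hs hm h]
    rw [hl.2, hr'.2, add_left_cancel hl.1, sub_right_inj.1 hr'.1]
  · rw [← hmid, heq, mid_self]
    ring
end

section
/- Let c > 0, U_L = (ρ_L,q_L) and U_R = (ρ_R,q_R) in Ω, and A > 0 such that A ≥ |q_L|/ρ_L + c and A ≥ |q_R|/ρ_R + c. Then the first component ρ_* of the middle state U_*(U_L,U_R) = (U_L+U_R)/2 − (1/(2A))(f(U_R) − f(U_L)) is strictly positive; explicitly, ρ_* = (ρ_L+ρ_R)/2 + (q_L−q_R)/(2A) ≥ c(ρ_L+ρ_R)/(2A) > 0. -/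
open Real Set

/-- positivity of the middle density of the Rusanov solver:
`ρ_* = (ρ_L+ρ_R)/2 + (q_L−q_R)/(2A) ≥ c(ρ_L+ρ_R)/(2A) > 0`. -/
theorem stmt2 (c A : ℝ) (hc : 0 < c) (hA : 0 < A)
    (UL UR : ℝ × ℝ) (hUL : UL ∈ Omega) (hUR : UR ∈ Omega)
    (hAL : |UL.2| / UL.1 + c ≤ A) (hAR : |UR.2| / UR.1 + c ≤ A) :
    (mid c A UL UR).1 = (UL.1 + UR.1) / 2 + (UL.2 - UR.2) / (2 * A) ∧
    c * (UL.1 + UR.1) / (2 * A) ≤ (UL.1 + UR.1) / 2 + (UL.2 - UR.2) / (2 * A) ∧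
    0 < c * (UL.1 + UR.1) / (2 * A) := by
  have hL : 0 < UL.1 := hUL
  have hR : 0 < UR.1 := hUR
  have momentum_bound {ρ q : ℝ} (hρ : 0 < ρ) (h : |q| / ρ + c ≤ A) : |q| ≤ (A - c) * ρ :=
    (div_le_iff₀ hρ).1 (le_sub_iff_add_le.2 h)
  refine ⟨?_, ?_, by positivity⟩
  · simp only [mid, flux, Prod.fst_sub, Prod.smul_fst, Prod.fst_add, smul_eq_mul]
    ring
  · have h : (UL.1 + UR.1) / 2 + (UL.2 - UR.2) / (2 * A) =
        (A * (UL.1 + UR.1) + (UL.2 - UR.2)) / (2 * A) := by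
      field_simp
    rw [h]
    gcongr
    linarith [momentum_bound hL hAL, momentum_bound hR hAR, neg_abs_le UL.2, le_abs_self UR.2]
end

section
/- Let c > 0, U_L, U_R ∈ Ω, and A > 0 with ρ_* := (ρ_L+ρ_R)/2 + (q_L−q_R)/(2A) > 0, and set U_* = (ρ_*, q_*) with q_* = (q_L+q_R)/2 + (η(U_L)−η(U_R))/(2A). Then the pair (U₋,U₊) = (U_*,U_*) solves the interface system for the classical coupling 𝒢₀: it satisfies q₋ = q₊, η(U₋) = η(U₊), F(U₊) − F(U₋) ≤ 0, and the flux-balance equation g_A(U_L,U₋) − f(U₋) + f(U₊) − g_A(U₊,U_R) = 0 in ℝ². -/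
open Real Set

/-- the pair `(U_*, U_*)` solves the interface system for the
classical coupling `𝒢₀`. -/
theorem stmt3 (c A : ℝ) (hc : 0 < c) (hA : 0 < A)
    (UL UR : ℝ × ℝ) (hUL : UL ∈ Omega) (hUR : UR ∈ Omega)
    (ρs qs : ℝ)
    (hρs : ρs = (UL.1 + UR.1) / 2 + (UL.2 - UR.2) / (2 * A))
    (hqs : qs = (UL.2 + UR.2) / 2 + (eta c UL - eta c UR) / (2 * A))
    (hρpos : 0 < ρs) :
    ((ρs, qs) : ℝ × ℝ) ∈ Omega ∧
    ((ρs, qs) : ℝ × ℝ).2 = ((ρs, qs) : ℝ × ℝ).2 ∧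
    eta c (ρs, qs) = eta c (ρs, qs) ∧
    entFlux c (ρs, qs) - entFlux c (ρs, qs) ≤ 0 ∧
    rus c A UL (ρs, qs) - flux c (ρs, qs) + flux c (ρs, qs) - rus c A (ρs, qs) UR = 0 := by
  refine ⟨hρpos, rfl, rfl, (sub_self _).le, ?_⟩
  have hmass : A * (2 * ρs - UL.1 - UR.1) = UL.2 - UR.2 := by
    rw [hρs]
    field_simp
    ring
  have hmom : A * (2 * qs - UL.2 - UR.2) = eta c UL - eta c UR := by
    rw [hqs]
    field_simp
    ring
  unfold eta at hmom
  ext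
  · simp only [rus, flux, Prod.fst_add, Prod.fst_sub, Prod.smul_fst, Prod.fst_zero, smul_eq_mul]
    linear_combination -hmass / 2
  · simp only [rus, flux, Prod.snd_add, Prod.snd_sub, Prod.smul_snd, Prod.snd_zero, smul_eq_mul]
    linear_combination -hmom / 2
end

section
/- Let c > 0, U_L, U_R ∈ Ω, and A > 0 with ρ_* := (ρ_L+ρ_R)/2 + (q_L−q_R)/(2A) > 0; set q_* = (q_L+q_R)/2 + (η(U_L)−η(U_R))/(2A) and U_* = (ρ_*,q_*). Consider the set S of pairs (U₋,U₊) ∈ Ω² satisfying q₋ = q₊, η(U₋) = η(U₊), and the flux-balance equation g_A(U_L,U₋) − f(U₋) + f(U₊) − g_A(U₊,U_R) = 0. Then: (i) if q_* = 0 or ρ_*² ≤ q_*²/c², then S = {(U_*,U_*)}; (ii) if q_* ≠ 0 and ρ_*² > q_*²/c², then, with r = √(ρ_*² − q_*²/c²), S consists of exactly the three pairs (U_*,U_*), ((ρ_*−r,q_*),(ρ_*+r,q_*)) and ((ρ_*+r,q_*),(ρ_*−r,q_*)). -/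
open Real Set

lemma eta_eq_iff {c a b q : ℝ} (ha : 0 < a) (hb : 0 < b) :
    eta c (a, q) = eta c (b, q) ↔ a = b ∨ c ^ 2 * (a * b) = q ^ 2 := by
  have key : eta c (a, q) - eta c (b, q) = (a - b) * (c ^ 2 * (a * b) - q ^ 2) / (a * b) := by
    simp only [eta]
    field_simp
    ring
  rw [← sub_eq_zero, key, div_eq_zero_iff, mul_eq_zero, sub_eq_zero, sub_eq_zero]
  simp [ha.ne', hb.ne']

/-- Between states with equal flux, the Rusanov flux balance says that the two states average to
the middle state. -/
lemma flux_balance_iff {c A : ℝ} (hA : 0 < A) {UL UR V W : ℝ × ℝ} (hVW : flux c V = flux c W) :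
    rus c A UL V - flux c V + flux c W - rus c A W UR = 0 ↔
      V + W = (2 : ℝ) • mid c A UL UR := by
  have key : rus c A UL V - flux c V + flux c W - rus c A W UR =
      (A / 2) • ((2 : ℝ) • mid c A UL UR - (V + W)) := by
    rw [rus, rus, mid, hVW]
    ext <;>
    · simp only [Prod.fst_add, Prod.fst_sub, Prod.smul_fst, Prod.snd_add, Prod.snd_sub,
        Prod.smul_snd, smul_eq_mul]
      field_simp
      ring
  rw [key, smul_eq_zero_iff_right (by positivity), sub_eq_zero, eq_comm]

/-- Admissible interface pairs: both momenta equal that of the middle state, the densities average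
to its density, and they are equal or have product `q² / c²`. -/
lemma interface_iff {c A : ℝ} (hA : 0 < A) {UL UR : ℝ × ℝ} {ρs qs : ℝ}
    (hmid : mid c A UL UR = (ρs, qs)) (a q b q' : ℝ) :
    ((a, q) ∈ Omega ∧ (b, q') ∈ Omega ∧ q = q' ∧ eta c (a, q) = eta c (b, q') ∧
      rus c A UL (a, q) - flux c (a, q) + flux c (b, q') - rus c A (b, q') UR = 0) ↔
    0 < a ∧ 0 < b ∧ q = qs ∧ q' = qs ∧ a + b = 2 * ρs ∧
      (a = b ∨ c ^ 2 * (a * b) = qs ^ 2) := by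
  constructor
  · rintro ⟨ha, hb, rfl, he, hf⟩
    have hflux : flux c (a, q) = flux c (b, q) := Prod.ext rfl he
    rw [flux_balance_iff hA hflux, hmid] at hf
    have h1 : a + b = 2 * ρs := congrArg Prod.fst hf
    have h2 : q + q = 2 * qs := congrArg Prod.snd hf
    obtain rfl : q = qs := by linarith
    exact ⟨ha, hb, rfl, rfl, h1, (eta_eq_iff ha hb).1 he⟩
  · rintro ⟨ha, hb, rfl, rfl, h1, h2⟩
    have he := (eta_eq_iff ha hb).2 h2
    have hflux : flux c (a, q') = flux c (b, q') := Prod.ext rfl he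
    refine ⟨ha, hb, rfl, he, ?_⟩
    rw [flux_balance_iff hA hflux, hmid]
    exact Prod.ext h1 (two_mul _).symm

/-- complete description of the solution set of the interface system
for the classical coupling `𝒢₀` with the Rusanov flux. -/
theorem stmt4 (c A : ℝ) (hc : 0 < c) (hA : 0 < A)
    (UL UR : ℝ × ℝ) (hUL : UL ∈ Omega) (hUR : UR ∈ Omega)
    (ρs qs : ℝ)
    (hρs : ρs = (UL.1 + UR.1) / 2 + (UL.2 - UR.2) / (2 * A))
    (hqs : qs = (UL.2 + UR.2) / 2 + (eta c UL - eta c UR) / (2 * A))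
    (hρpos : 0 < ρs)
    (S : Set ((ℝ × ℝ) × (ℝ × ℝ)))
    (hSdef : S = {p | p.1 ∈ Omega ∧ p.2 ∈ Omega ∧ p.1.2 = p.2.2 ∧
      eta c p.1 = eta c p.2 ∧
      rus c A UL p.1 - flux c p.1 + flux c p.2 - rus c A p.2 UR = 0})
    (r : ℝ) (hr : r = Real.sqrt (ρs ^ 2 - qs ^ 2 / c ^ 2)) :
    ((qs = 0 ∨ ρs ^ 2 ≤ qs ^ 2 / c ^ 2) →
      S = {(((ρs, qs) : ℝ × ℝ), ((ρs, qs) : ℝ × ℝ))}) ∧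
    ((qs ≠ 0 ∧ ρs ^ 2 > qs ^ 2 / c ^ 2) →
      S = {(((ρs, qs) : ℝ × ℝ), ((ρs, qs) : ℝ × ℝ)),
           (((ρs - r, qs) : ℝ × ℝ), ((ρs + r, qs) : ℝ × ℝ)),
           (((ρs + r, qs) : ℝ × ℝ), ((ρs - r, qs) : ℝ × ℝ))} ∧
      (((ρs, qs) : ℝ × ℝ), ((ρs, qs) : ℝ × ℝ)) ≠
        (((ρs - r, qs) : ℝ × ℝ), ((ρs + r, qs) : ℝ × ℝ)) ∧
      (((ρs, qs) : ℝ × ℝ), ((ρs, qs) : ℝ × ℝ)) ≠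
        (((ρs + r, qs) : ℝ × ℝ), ((ρs - r, qs) : ℝ × ℝ)) ∧
      (((ρs - r, qs) : ℝ × ℝ), ((ρs + r, qs) : ℝ × ℝ)) ≠
        (((ρs + r, qs) : ℝ × ℝ), ((ρs - r, qs) : ℝ × ℝ))) := by
  have hmid : mid c A UL UR = (ρs, qs) := by
    rw [hρs, hqs]
    ext <;>
    · simp only [mid, flux, eta, Prod.fst_add, Prod.fst_sub, Prod.smul_fst, Prod.snd_add,
        Prod.snd_sub, Prod.smul_snd, smul_eq_mul]
      ring
  have hc2 : 0 < c ^ 2 := by positivity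
  have hprod : ∀ a b : ℝ, a + b = 2 * ρs → c ^ 2 * (a * b) = qs ^ 2 →
      (a - ρs) ^ 2 = ρs ^ 2 - qs ^ 2 / c ^ 2 := by
    intro a b hab h
    rw [← h, mul_div_cancel_left₀ _ hc2.ne']
    obtain rfl : b = 2 * ρs - a := by linarith
    ring
  subst hSdef
  refine ⟨fun h => ?_, fun ⟨hq, hlt⟩ => ?_⟩
  · ext ⟨⟨a, q⟩, ⟨b, q'⟩⟩
    simp only [mem_ofPred_eq, interface_iff hA hmid, mem_singleton_iff, Prod.mk.injEq]
    constructor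
    · rintro ⟨ha, hb, rfl, rfl, hab, rfl | hp⟩
      · exact ⟨⟨by linarith, rfl⟩, by linarith, rfl⟩
      · rcases h with rfl | h
        · have : 0 < c ^ 2 * (a * b) := by positivity
          simp [hp] at this
        · have hs := hprod a b hab hp
          have h0 : a - ρs = 0 := pow_eq_zero_iff two_ne_zero |>.1
            (le_antisymm (by linarith) (sq_nonneg _))
          exact ⟨⟨by linarith, rfl⟩, by linarith, rfl⟩
    · rintro ⟨⟨rfl, rfl⟩, rfl, rfl⟩
      exact ⟨hρpos, hρpos, rfl, rfl, (two_mul _).symm, Or.inl rfl⟩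
  · have hr0 : 0 < r := hr ▸ Real.sqrt_pos.2 (sub_pos.2 hlt)
    have hr2 : r ^ 2 = ρs ^ 2 - qs ^ 2 / c ^ 2 := hr ▸ Real.sq_sqrt (sub_pos.2 hlt).le
    have hrρ : r < ρs := by
      have : 0 < qs ^ 2 / c ^ 2 := by positivity
      exact lt_of_pow_lt_pow_left₀ 2 hρpos.le (by linarith)
    have hrp : c ^ 2 * ((ρs - r) * (ρs + r)) = qs ^ 2 := by
      have : (ρs - r) * (ρs + r) = qs ^ 2 / c ^ 2 := by linear_combination -hr2
      rw [this, mul_div_cancel₀ _ hc2.ne']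
    refine ⟨?_, ?_, ?_, ?_⟩
    · ext ⟨⟨a, q⟩, ⟨b, q'⟩⟩
      simp only [mem_ofPred_eq, interface_iff hA hmid, mem_insert_iff, mem_singleton_iff,
        Prod.mk.injEq]
      constructor
      · rintro ⟨ha, hb, rfl, rfl, hab, rfl | hp⟩
        · exact Or.inl ⟨⟨by linarith, rfl⟩, by linarith, rfl⟩
        · rcases sq_eq_sq_iff_eq_or_eq_neg.1 ((hprod a b hab hp).trans hr2.symm) with h | h
          · exact Or.inr (Or.inr ⟨⟨by linarith, rfl⟩, by linarith, rfl⟩)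
          · exact Or.inr (Or.inl ⟨⟨by linarith, rfl⟩, by linarith, rfl⟩)
      · rintro (⟨⟨rfl, rfl⟩, rfl, rfl⟩ | ⟨⟨rfl, rfl⟩, rfl, rfl⟩ | ⟨⟨rfl, rfl⟩, rfl, rfl⟩)
        · exact ⟨hρpos, hρpos, rfl, rfl, (two_mul _).symm, Or.inl rfl⟩
        · exact ⟨by linarith, by linarith, rfl, rfl, by ring, Or.inr hrp⟩
        · exact ⟨by linarith, by linarith, rfl, rfl, by ring, Or.inr (by rwa [mul_comm (ρs + r)])⟩
    all_goals
      intro h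
      have := congrArg (fun p => p.1.1) h
      dsimp only at this
      linarith
end

section
/- Let c > 0, q > 0, and ρ₋, ρ₊ > 0 with ρ₋ < ρ₊ and ρ₋·ρ₊ = q²/c² (an admissible stationary shock of the isothermal Euler equations). Then q/ρ₋ > c > q/ρ₊, and the entropy flux strictly decreases across the shock: F(ρ₊,q) < F(ρ₋,q). -/
open Real Set

/-- For `0 < a < b`, `log (b / a) < (b / a - a / b) / 2`. -/
lemma log_sub_log_lt {a b : ℝ} (ha : 0 < a) (hab : a < b) :
    Real.log b - Real.log a < (b / a - a / b) / 2 := by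
  have hb : 0 < b := ha.trans hab
  have h := Real.self_lt_sinh_iff.2 (Real.log_pos ((one_lt_div ha).2 hab))
  rwa [Real.sinh_log (div_pos hb ha), inv_div, Real.log_div hb.ne' ha.ne'] at h

/-- Velocity form of the entropy flux. -/
lemma entFlux_eq (c q : ℝ) {ρ : ℝ} (hρ : 0 < ρ) :
    entFlux c (ρ, q) = q * (q ^ 2 / (2 * ρ ^ 2) + c ^ 2 * Real.log ρ + c ^ 2) := by
  simp only [entFlux, ent]
  field_simp

/-- across an admissible stationary shock (`q > 0`, `ρ₋ < ρ₊`,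
`ρ₋ρ₊ = q²/c²`), the flow is supersonic upstream, subsonic downstream,
and the entropy flux strictly decreases. -/
theorem stmt5 (c q ρm ρp : ℝ) (hc : 0 < c) (hq : 0 < q)
    (hρm : 0 < ρm) (hρp : 0 < ρp) (hlt : ρm < ρp)
    (hshock : ρm * ρp = q ^ 2 / c ^ 2) :
    q / ρm > c ∧ c > q / ρp ∧ entFlux c (ρp, q) < entFlux c (ρm, q) := by
  have hq2 : q ^ 2 = c ^ 2 * (ρm * ρp) := by
    rw [hshock]
    field_simp
  refine ⟨?_, ?_, ?_⟩
  · rw [gt_iff_lt, lt_div_iff₀ hρm]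
    refine lt_of_pow_lt_pow_left₀ 2 hq.le ?_
    rw [hq2, mul_pow, pow_two ρm]
    gcongr
  · rw [gt_iff_lt, div_lt_iff₀ hρp]
    refine lt_of_pow_lt_pow_left₀ 2 (by positivity) ?_
    rw [hq2, mul_pow, pow_two ρp]
    gcongr
  · have hm : q ^ 2 / (2 * ρm ^ 2) = c ^ 2 * (ρp / ρm / 2) := by
      rw [hq2]
      field_simp
    have hp : q ^ 2 / (2 * ρp ^ 2) = c ^ 2 * (ρm / ρp / 2) := by
      rw [hq2]
      field_simp
    rw [entFlux_eq c q hρp, entFlux_eq c q hρm, hm, hp]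
    refine mul_lt_mul_of_pos_left ?_ hq
    linarith [mul_lt_mul_of_pos_left (log_sub_log_lt hρm hlt) (pow_pos hc 2)]
end

section
/- Let c > 0, let U₀, U₁ ∈ Ω, and suppose A > 0 satisfies the subcharacteristic condition for the pair (U₀,U₁); let U_* = U_*(U₀,U₁) be the middle state. Then the numerical entropy flux is non-increasing across the interface: F̂_A(U₀,U_*) ≥ F̂_A(U_*,U₁). -/
open Real Set

/-- The second-order Taylor lower bound `t + t²/2 ≤ -log (1 - t)` on `[0, 1)`, written for
`t = 1 - 1/r`. -/
lemma add_sq_div_two_le_log {r : ℝ} (hr : 1 ≤ r) :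
    (1 - r⁻¹) + (1 - r⁻¹) ^ 2 / 2 ≤ Real.log r := by
  have hr0 : 0 < r := by linarith
  have ht0 : 0 ≤ 1 - r⁻¹ := sub_nonneg.2 (inv_le_one_of_one_le₀ hr)
  have ht1 : |1 - r⁻¹| < 1 := by
    rw [abs_of_nonneg ht0]
    linarith [inv_pos.2 hr0]
  have h := sum_le_hasSum (Finset.range 2) (fun n _ => by positivity)
    (Real.hasSum_pow_div_log_of_abs_lt_one ht1)
  rw [sub_sub_cancel, Real.log_inv, neg_neg] at h
  norm_num [Finset.sum_range_succ] at h
  linarith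

lemma log_sq_div_two_le {r : ℝ} (hr0 : 0 < r) (hr : r ≤ 1) :
    (Real.log r) ^ 2 / 2 ≤ r⁻¹ - 1 + Real.log r := by
  have h := Real.quadratic_le_exp_of_nonneg (neg_nonneg.2 (Real.log_nonpos hr0.le hr))
  rw [Real.exp_neg, Real.exp_log hr0] at h
  linarith

/-- Nonnegativity of `A E(U|V) + F(U|V)`, the relative entropy and entropy flux of the states
`U = (ρ, ρu)` and `V = (σ, σv)`. -/
lemma relative_entropy_add_flux_nonneg {c A ρ σ u v : ℝ} (hc : 0 < c) (hρ : 0 < ρ) (hσ : 0 < σ)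
    (hu : c ≤ A + u) (hv : c ≤ A + v) :
    0 ≤ (A + u) * (ρ * (u - v) ^ 2 / 2
        + c ^ 2 * (ρ * (Real.log ρ - Real.log σ) - ρ + σ))
      + c ^ 2 * (u - v) * (ρ - σ) := by
  obtain ⟨w, rfl⟩ : ∃ w, u = v + w := ⟨u - v, by ring⟩
  obtain ⟨r, rfl⟩ : ∃ r, ρ = r * σ := ⟨ρ / σ, by field_simp⟩
  have hr : 0 < r := pos_of_mul_pos_left hρ hσ.le
  rw [Real.log_mul hr.ne' hσ.ne']
  set L := Real.log r with hL
  have hri : r * r⁻¹ = 1 := mul_inv_cancel₀ hr.ne'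
  set k := r⁻¹ with hk
  have hlog : 0 ≤ L - 1 + k := by
    have := Real.one_sub_inv_le_log_of_pos hr
    linarith
  have hfactor : (A + (v + w)) * (r * σ * (v + w - v) ^ 2 / 2
        + c ^ 2 * (r * σ * (L + Real.log σ - Real.log σ) - r * σ + σ))
        + c ^ 2 * (v + w - v) * (r * σ - σ)
      = r * σ * ((A + (v + w)) * (w ^ 2 / 2 + c ^ 2 * (L - 1 + k)) + c ^ 2 * w * (1 - k)) := by
    linear_combination (-(A + (v + w)) * c ^ 2 * σ + c ^ 2 * w * σ) * hri
  rw [hfactor]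
  refine mul_nonneg hρ.le ?_
  have hE : 0 ≤ w ^ 2 / 2 + c ^ 2 * (L - 1 + k) := by positivity
  rcases le_total 1 r with h1 | h1
  · have hL2 := add_sq_div_two_le_log h1
    rw [← hL, ← hk] at hL2
    have hlower := mul_le_mul_of_nonneg_right hu hE
    have hquad : c ^ 2 * ((1 - k) ^ 2 / 2) ≤ c ^ 2 * (L - 1 + k) := by
      gcongr
      linarith
    have := mul_le_mul_of_nonneg_left hquad hc.le
    nlinarith [mul_nonneg hc.le (sq_nonneg (w + c * (1 - k)))]
  · have hk1 : 1 ≤ k := (one_le_inv₀ hr).2 h1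
    have hL2 := log_sq_div_two_le hr h1
    rw [← hL, ← hk] at hL2
    rcases le_total w 0 with hw | hw
    · have h2 : 0 ≤ c ^ 2 * (w * (1 - k)) :=
        mul_nonneg (sq_nonneg c) (mul_nonneg_of_nonpos_of_nonpos hw (by linarith))
      have h3 := mul_nonneg (hc.le.trans hu) hE
      linarith
    · have hlower := mul_le_mul_of_nonneg_right (show c + w ≤ A + (v + w) by linarith) hE
      have hquad : c ^ 3 * (L ^ 2 / 2) ≤ c ^ 3 * (k - 1 + L) := by gcongr
      have hw3 : 0 ≤ w ^ 3 := pow_nonneg hw 3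
      nlinarith [mul_nonneg hc.le (sq_nonneg (w + c * L))]

/-- the numerical entropy flux is non-increasing across the interface:
`F̂_A(U₀,U_*) ≥ F̂_A(U_*,U₁)`. -/
theorem stmt7 (c A : ℝ) (hc : 0 < c) (hA : 0 < A)
    (U0 U1 : ℝ × ℝ) (hU0 : U0 ∈ Omega) (hU1 : U1 ∈ Omega)
    (hsub : subchar c A U0 U1) :
    numEntFlux c A (mid c A U0 U1) U1 ≤ numEntFlux c A U0 (mid c A U0 U1) := by
  obtain ⟨hσ, hmax⟩ := hsub
  have hm1 : 2 * A * (mid c A U0 U1).1 = A * (U0.1 + U1.1) - (U1.2 - U0.2) := by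
    simp only [mid, flux, Prod.fst_sub, Prod.smul_fst, Prod.fst_add, smul_eq_mul]
    field_simp
  have hm2 : 2 * A * (mid c A U0 U1).2 = A * (U0.2 + U1.2)
      - (U1.2 ^ 2 / U1.1 + c ^ 2 * U1.1 - (U0.2 ^ 2 / U0.1 + c ^ 2 * U0.1)) := by
    simp only [mid, flux, Prod.snd_sub, Prod.smul_snd, Prod.snd_add, smul_eq_mul]
    generalize U1.2 ^ 2 / U1.1 = a
    generalize U0.2 ^ 2 / U0.1 = b
    field_simp
  generalize mid c A U0 U1 = V at *
  obtain ⟨ρ, p⟩ := U0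
  obtain ⟨τ, q⟩ := U1
  obtain ⟨σ, m⟩ := V
  simp only [Omega, mem_ofPred_eq] at hU0 hU1
  dsimp only at hσ hmax hm1 hm2
  obtain ⟨u, rfl⟩ : ∃ u, p = ρ * u := ⟨p / ρ, by field_simp⟩
  obtain ⟨z, rfl⟩ : ∃ z, q = τ * z := ⟨q / τ, by field_simp⟩
  obtain ⟨v, rfl⟩ : ∃ v, m = σ * v := ⟨m / σ, by field_simp⟩
  have habs {a b : ℝ} (ha : 0 < a) : |a * b| / a = |b| := by
    rw [abs_mul, abs_of_pos ha, mul_div_cancel_left₀ _ ha.ne']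
  have hsq {a b : ℝ} (ha : 0 < a) : (a * b) ^ 2 / a = a * b ^ 2 := by field_simp
  have hsq2 {a b : ℝ} (ha : 0 < a) : (a * b) ^ 2 / (2 * a) = a * b ^ 2 / 2 := by field_simp
  rw [habs hU0, habs hU1, habs hσ, ← le_sub_iff_add_le, max_le_iff, max_le_iff] at hmax
  rw [hsq hU0, hsq hU1] at hm2
  obtain ⟨hu, hz, hv⟩ := hmax
  rw [abs_le] at hu hz hv
  have h0 := relative_entropy_add_flux_nonneg (A := A) (u := u) (v := v) hc hU0 hσ
    (by linarith [hu.1]) (by linarith [hv.1])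
  have h1 := relative_entropy_add_flux_nonneg (A := A) (u := -z) (v := -v) hc hU1 hσ
    (by linarith [hz.2]) (by linarith [hv.2])
  simp only [numEntFlux, entFlux, ent, hsq2 hU0, hsq2 hU1, hsq2 hσ,
    mul_div_cancel_left₀ _ hU0.ne', mul_div_cancel_left₀ _ hU1.ne', mul_div_cancel_left₀ _ hσ.ne']
  linear_combination (h0 + h1) / 2
    + (-v ^ 2 / 2 + c ^ 2 * (Real.log σ + 1)) / 2 * hm1 + v / 2 * hm2
end

section
/- Let c > 0 and U = (ρ,q) ∈ Ω with q ≠ 0 and c·ρ > |q|, and set r = √(ρ² − q²/c²) > 0, U₋ = (ρ−r, q), U₊ = (ρ+r, q). Then E(U₋) + E(U₊) > 2E(U). Consequently, for every A > 0 the nontrivial interface pair (U₋,U₊) violates the interface entropy inequality F(U₁) − F(U₀) ≤ A·(E(U₀) + E(U₁) − E(U₋) − E(U₊)) when U₀ = U₁ = U: the scheme is consistent, i.e. for constant data the only entropy-admissible choice is U₋ = U₊ = U. -/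
open Real Set

/-- for subsonic constant data, the nontrivial interface pair strictly
increases the entropy, hence violates the interface entropy inequality: the scheme
is consistent. -/
theorem stmt9 (c : ℝ) (hc : 0 < c) (ρ q : ℝ) (hρ : 0 < ρ) (hq : q ≠ 0)
    (hsub : c * ρ > |q|)
    (r : ℝ) (hr : r = Real.sqrt (ρ ^ 2 - q ^ 2 / c ^ 2))
    (Um Up : ℝ × ℝ) (hUm : Um = (ρ - r, q)) (hUp : Up = (ρ + r, q)) :
    0 < r ∧
    ent c Um + ent c Up > 2 * ent c (ρ, q) ∧
    ∀ A : ℝ, 0 < A →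
      ¬ (entFlux c (ρ, q) - entFlux c (ρ, q) ≤
        A * (ent c (ρ, q) + ent c (ρ, q) - ent c Um - ent c Up)) := by
  have hqc : q ^ 2 / c ^ 2 < ρ ^ 2 := by
    rw [div_lt_iff₀ (by positivity), ← mul_pow, mul_comm ρ c, sq_lt_sq, abs_of_pos (mul_pos hc hρ)]
    exact hsub
  have hq2 : 0 < q ^ 2 := by positivity
  have hr0 : 0 < r := hr ▸ Real.sqrt_pos.2 (sub_pos.2 hqc)
  have hrρ : r < ρ := by
    rw [hr, Real.sqrt_lt' hρ]
    exact sub_lt_self _ (by positivity)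
  have hm : 0 < ρ - r := sub_pos.2 hrρ
  have hp : 0 < ρ + r := add_pos hρ hr0
  have hlog : 2 * (ρ * Real.log ρ) <
      (ρ - r) * Real.log (ρ - r) + (ρ + r) * Real.log (ρ + r) := by
    have h := Real.strictConvexOn_mul_log.2 (Set.mem_Ici.2 hm.le) (Set.mem_Ici.2 hp.le)
      (by linarith : ρ - r < ρ + r).ne (by norm_num : (0 : ℝ) < 1 / 2)
      (by norm_num : (0 : ℝ) < 1 / 2) (by norm_num)
    have hmid : (1 / 2 : ℝ) • (ρ - r) + (1 / 2 : ℝ) • (ρ + r) = ρ := by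
      simp only [smul_eq_mul]
      ring
    rw [hmid] at h
    simp only [smul_eq_mul] at h
    linarith
  have hkin : 2 * (q ^ 2 / (2 * ρ)) < q ^ 2 / (2 * (ρ - r)) + q ^ 2 / (2 * (ρ + r)) := by
    have h : q ^ 2 / (2 * (ρ - r)) + q ^ 2 / (2 * (ρ + r)) - 2 * (q ^ 2 / (2 * ρ)) =
        q ^ 2 * r ^ 2 / ((ρ - r) * (ρ + r) * ρ) := by
      field_simp
      ring
    have hpos : 0 < q ^ 2 * r ^ 2 / ((ρ - r) * (ρ + r) * ρ) := by positivity
    linarith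
  have hent : ent c Um + ent c Up > 2 * ent c (ρ, q) := by
    subst hUm hUp
    simp only [ent]
    have h := mul_lt_mul_of_pos_left hlog (pow_pos hc 2)
    linarith
  refine ⟨hr0, hent, fun A hA => ?_⟩
  rw [sub_self, not_le]
  exact mul_neg_of_pos_of_neg hA (by linarith)
end

section
/- Let c > 0 and let U_L = (ρ_L,q), U_R = (ρ_R,q) ∈ Ω be an admissible stationary shock: q ≠ 0, q/ρ_L > q/ρ_R, ρ_L ≠ ρ_R and ρ_L·ρ_R = q²/c². Then for any A > 0: η(U_L) = η(U_R), hence the interface middle values are ρ_* = (ρ_L+ρ_R)/2 and q_* = q; moreover ρ_* > |q|/c, the root r = √(ρ_*² − q²/c²) equals |ρ_R − ρ_L|/2, and the entropy-selected nontrivial solution coincides with the data: (ρ_* − sign(q)·r, q_*) = U_L and (ρ_* + sign(q)·r, q_*) = U_R. -/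
open Real Set

/-- Two nonzero densities on the same stationary shock curve carry the same momentum flux. -/
theorem eta_eq_eta_of_mul_eq {c ρL ρR q : ℝ} (hc : c ≠ 0) (hρL : ρL ≠ 0) (hρR : ρR ≠ 0)
    (hshock : ρL * ρR = q ^ 2 / c ^ 2) : eta c (ρL, q) = eta c (ρR, q) := by
  have hq2 : q ^ 2 = c ^ 2 * (ρL * ρR) := by
    rw [hshock]
    field_simp
  simp only [eta, hq2]
  field_simp
  ring

/-- The admissibility inequality says that the density jump has the sign of `q`. -/
theorem sign_mul_abs_sub_of_div_lt_div {ρL ρR q : ℝ} (hρL : 0 < ρL) (hρR : 0 < ρR)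
    (hadm : q / ρR < q / ρL) : Real.sign q * |ρR - ρL| = ρR - ρL := by
  rw [div_lt_div_iff₀ hρR hρL] at hadm
  rcases lt_trichotomy q 0 with hq | rfl | hq
  · have hlt : ρR < ρL := by nlinarith
    rw [Real.sign_of_neg hq, abs_of_neg (sub_neg.mpr hlt)]
    ring
  · simp at hadm
  · have hlt : ρL < ρR := by nlinarith
    rw [Real.sign_of_pos hq, abs_of_pos (sub_pos.mpr hlt), one_mul]

/-- for an admissible stationary shock the interface middle values are
`ρ_* = (ρ_L+ρ_R)/2`, `q_* = q`, the root is `r = |ρ_R−ρ_L|/2` and the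
entropy-selected nontrivial solution coincides with the data. -/
theorem stmt10 (c : ℝ) (hc : 0 < c) (ρL ρR q : ℝ) (hρL : 0 < ρL) (hρR : 0 < ρR)
    (hq : q ≠ 0) (hadm : q / ρL > q / ρR) (hne : ρL ≠ ρR)
    (hshock : ρL * ρR = q ^ 2 / c ^ 2)
    (A : ℝ) (hA : 0 < A)
    (ρs qs r : ℝ)
    (hρs : ρs = (ρL + ρR) / 2 + (q - q) / (2 * A))
    (hqs : qs = (q + q) / 2 + (eta c (ρL, q) - eta c (ρR, q)) / (2 * A))
    (hr : r = Real.sqrt (ρs ^ 2 - qs ^ 2 / c ^ 2)) :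
    eta c (ρL, q) = eta c (ρR, q) ∧
    ρs = (ρL + ρR) / 2 ∧
    qs = q ∧
    ρs > |q| / c ∧
    r = |ρR - ρL| / 2 ∧
    ((ρs - Real.sign q * r, qs) : ℝ × ℝ) = (ρL, q) ∧
    ((ρs + Real.sign q * r, qs) : ℝ × ℝ) = (ρR, q) := by
  have heta := eta_eq_eta_of_mul_eq hc.ne' hρL.ne' hρR.ne' hshock
  have hρs' : ρs = (ρL + ρR) / 2 := by rw [hρs, sub_self, zero_div, add_zero]
  have hqs' : qs = q := by rw [hqs, heta, sub_self, zero_div, add_zero, add_self_div_two]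
  have hr' : r = |ρR - ρL| / 2 := by
    have hsq : ρs ^ 2 - qs ^ 2 / c ^ 2 = ((ρR - ρL) / 2) ^ 2 := by
      rw [hρs', hqs', ← hshock]
      ring
    rw [hr, hsq, Real.sqrt_sq_eq_abs, abs_div, abs_two]
  have hsign : Real.sign q * r = (ρR - ρL) / 2 := by
    rw [hr', ← mul_div_assoc, sign_mul_abs_sub_of_div_lt_div hρL hρR hadm]
  refine ⟨heta, hρs', hqs', ?_, hr', ?_, ?_⟩
  · have hsq : (|q| / c) ^ 2 < ρs ^ 2 := by
      rw [div_pow, sq_abs, ← hshock, hρs']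
      nlinarith [sq_pos_of_ne_zero (sub_ne_zero.mpr hne)]
    exact lt_of_pow_lt_pow_left₀ 2 (by rw [hρs']; positivity) hsq
  · rw [hsign, hρs', hqs']
    ring_nf
  · rw [hsign, hρs', hqs']
    ring_nf
end

section
/- Let c > 0, λ ≥ 0, U₀, U₁ ∈ Ω, and A > 0 with ρ_* := (ρ₀+ρ₁)/2 + (q₀−q₁)/(2A) > 0. Then the set of pairs (U₋,U₊) ∈ Ω² satisfying q₋ = q₊ =: q, η(U₋) − η(U₊) = λq, and the flux-balance equation g_A(U₀,U₋) − f(U₋) + f(U₊) − g_A(U₊,U₁) = 0 is nonempty and contains at most three elements. -/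
open Real Set

/-- The real roots of a cubic are among three numbers. -/
theorem exists_three_of_cubic (a b d e : ℝ) (ha : a ≠ 0) :
    ∃ x y z : ℝ, ∀ t, a * t ^ 3 + b * t ^ 2 + d * t + e = 0 → t = x ∨ t = y ∨ t = z := by
  by_cases h : ∃ x y, x ≠ y ∧ a * x ^ 3 + b * x ^ 2 + d * x + e = 0 ∧
      a * y ^ 3 + b * y ^ 2 + d * y + e = 0
  · obtain ⟨x, y, hxy, hx, hy⟩ := h
    refine ⟨x, y, -b / a - x - y, fun t ht => ?_⟩
    by_contra! hne
    obtain ⟨htx, hty, htz⟩ := hne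
    have h1 : a * (t ^ 2 + t * x + x ^ 2) + b * (t + x) + d = 0 :=
      mul_left_cancel₀ (sub_ne_zero.2 htx) (by linear_combination ht - hx)
    have h2 : a * (y ^ 2 + y * x + x ^ 2) + b * (y + x) + d = 0 :=
      mul_left_cancel₀ (sub_ne_zero.2 hxy.symm) (by linear_combination hy - hx)
    have h3 : a * (t + x + y) + b = 0 :=
      mul_left_cancel₀ (sub_ne_zero.2 hty) (by linear_combination h1 - h2)
    refine htz ?_
    field_simp
    linear_combination h3
  · push Not at h
    by_cases h' : ∃ x, a * x ^ 3 + b * x ^ 2 + d * x + e = 0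
    · obtain ⟨x, hx⟩ := h'
      refine ⟨x, x, x, fun t ht => Or.inl ?_⟩
      by_contra hne
      exact h t x hne ht hx
    · exact ⟨0, 0, 0, fun t ht => (h' ⟨t, ht⟩).elim⟩

/-- The density jump equation has a solution with both densities `R + t`, `R - t` positive. -/
theorem exists_density_jump (c lam q R : ℝ) (hR : 0 < R) :
    ∃ t ∈ Ioo (-R) R, -2 * t * q ^ 2 + 2 * c ^ 2 * t * (R ^ 2 - t ^ 2)
      - lam * q * (R ^ 2 - t ^ 2) = 0 := by
  rcases eq_or_ne q 0 with rfl | hq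
  · exact ⟨0, ⟨by linarith, hR⟩, by ring⟩
  · have hq2 : 0 < R * q ^ 2 := by positivity
    have hcont : ContinuousOn (fun t : ℝ => -2 * t * q ^ 2 + 2 * c ^ 2 * t * (R ^ 2 - t ^ 2)
        - lam * q * (R ^ 2 - t ^ 2)) (Icc (-R) R) := by fun_prop
    obtain ⟨t, ht, h⟩ := intermediate_value_Ioo' (by linarith) hcont
      (show (0 : ℝ) ∈ Ioo _ _ from ⟨by nlinarith, by nlinarith⟩)
    exact ⟨t, ht, h⟩

/-- For states with common momentum `q` and densities `R + t`, `R - t`, the momentum loss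
condition is a cubic equation in `t`. -/
theorem eta_sub_eta_eq_iff (c lam q R t : ℝ) (h₁ : 0 < R + t) (h₂ : 0 < R - t) :
    eta c (R + t, q) - eta c (R - t, q) = lam * q ↔
      -2 * t * q ^ 2 + 2 * c ^ 2 * t * (R ^ 2 - t ^ 2) - lam * q * (R ^ 2 - t ^ 2) = 0 := by
  have key : (eta c (R + t, q) - eta c (R - t, q) - lam * q) * ((R + t) * (R - t)) =
      -2 * t * q ^ 2 + 2 * c ^ 2 * t * (R ^ 2 - t ^ 2) - lam * q * (R ^ 2 - t ^ 2) := by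
    simp only [eta]
    field_simp
    ring
  rw [← key, mul_eq_zero, or_iff_left (mul_pos h₁ h₂).ne', sub_eq_zero]

/-- Flux balance across an interface in `𝒢̃_λ` fixes the mean density and the momentum. -/
theorem flux_balance_iff_s12 (c lam A : ℝ) (hlam : 0 ≤ lam) (hA : 0 < A) (U0 U1 : ℝ × ℝ)
    (r s q : ℝ) (h : eta c (r, q) - eta c (s, q) = lam * q) :
    rus c A U0 (r, q) - flux c (r, q) + flux c (s, q) - rus c A (s, q) U1 = 0 ↔
      r + s = 2 * ((U0.1 + U1.1) / 2 + (U0.2 - U1.2) / (2 * A)) ∧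
      q = (eta c U0 - eta c U1 + A * (U0.2 + U1.2)) / (2 * A + lam) := by
  have hAl : 2 * A + lam ≠ 0 := by positivity
  rw [eq_div_iff hAl]
  have hm : r + s = 2 * ((U0.1 + U1.1) / 2 + (U0.2 - U1.2) / (2 * A)) ↔
      A * (r + s) = A * (U0.1 + U1.1) + (U0.2 - U1.2) := by
    rw [← mul_right_inj' hA.ne']
    field_simp
  rw [hm]
  simp only [eta] at h ⊢
  simp only [Prod.ext_iff, rus, flux, Prod.fst_add, Prod.snd_add, Prod.fst_sub, Prod.snd_sub,
    Prod.smul_fst, Prod.smul_snd, smul_eq_mul, Prod.fst_zero, Prod.snd_zero]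
  refine and_congr ⟨fun e => ?_, fun e => ?_⟩ ⟨fun e => ?_, fun e => ?_⟩ <;> linarith

/-- the interface system for `𝒢̃_λ` with the Rusanov flux has at least
one and at most three solutions. -/
theorem stmt12 (c lam A : ℝ) (hc : 0 < c) (hlam : 0 ≤ lam) (hA : 0 < A)
    (U0 U1 : ℝ × ℝ) (hU0 : U0 ∈ Omega) (hU1 : U1 ∈ Omega)
    (hρs : 0 < (U0.1 + U1.1) / 2 + (U0.2 - U1.2) / (2 * A))
    (S : Set ((ℝ × ℝ) × (ℝ × ℝ)))
    (hSdef : S = {p | p.1 ∈ Omega ∧ p.2 ∈ Omega ∧ p.1.2 = p.2.2 ∧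
      eta c p.1 - eta c p.2 = lam * p.1.2 ∧
      rus c A U0 p.1 - flux c p.1 + flux c p.2 - rus c A p.2 U1 = 0}) :
    S.Nonempty ∧ ∃ a b d : (ℝ × ℝ) × (ℝ × ℝ), S ⊆ {a, b, d} := by
  set R := (U0.1 + U1.1) / 2 + (U0.2 - U1.2) / (2 * A) with hR
  set Q := (eta c U0 - eta c U1 + A * (U0.2 + U1.2)) / (2 * A + lam)
  subst hSdef
  constructor
  · obtain ⟨t, ⟨ht₁, ht₂⟩, ht⟩ := exists_density_jump c lam Q R hρs
    have h₁ : 0 < R + t := by linarith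
    have h₂ : 0 < R - t := by linarith
    have hη := (eta_sub_eta_eq_iff c lam Q R t h₁ h₂).2 ht
    exact ⟨((R + t, Q), (R - t, Q)), h₁, h₂, rfl, hη,
      (flux_balance_iff_s12 c lam A hlam hA U0 U1 _ _ Q hη).2 ⟨by ring, rfl⟩⟩
  · obtain ⟨x, y, z, hroots⟩ := exists_three_of_cubic (-2 * c ^ 2) (lam * Q)
      (2 * c ^ 2 * R ^ 2 - 2 * Q ^ 2) (-lam * Q * R ^ 2)
      (mul_ne_zero (by norm_num) (pow_ne_zero 2 hc.ne'))
    refine ⟨((R + x, Q), (R - x, Q)), ((R + y, Q), (R - y, Q)), ((R + z, Q), (R - z, Q)), ?_⟩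
    rintro ⟨⟨r, q⟩, ⟨s, q'⟩⟩ ⟨hr, hs, hq, hη, hbal⟩
    obtain rfl : q = q' := hq
    obtain ⟨hrs, hqQ⟩ := (flux_balance_iff_s12 c lam A hlam hA U0 U1 r s q hη).1 hbal
    obtain ⟨t, rfl⟩ : ∃ t, r = R + t := ⟨r - R, by ring⟩
    obtain rfl : s = R - t := by linarith
    obtain rfl : q = Q := hqQ
    have ht := (eta_sub_eta_eq_iff c lam Q R t hr hs).1 hη
    rcases hroots t (by linear_combination ht) with rfl | rfl | rfl <;> simp
end

section
/- Let c > 0, λ ≥ 0, U₀, U₁ ∈ Ω, and A > 0 with ρ_* := (ρ₀+ρ₁)/2 + (q₀−q₁)/(2A) > 0, and set q̂ = (A(q₀+q₁) + η(U₀) − η(U₁))/(λ+2A). Then a pair (U₋,U₊) ∈ Ω² satisfies q₋ = q₊, η(U₋) − η(U₊) = λq₋ and the flux-balance equation g_A(U₀,U₋) − f(U₋) + f(U₊) − g_A(U₊,U₁) = 0 if and only if q₋ = q₊ = q̂, ρ₋ + ρ₊ = 2ρ_*, and the root r := (ρ₊ − ρ₋)/2 ∈ (−ρ_*, ρ_*)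 satisfies (q̂²/(ρ_*−r) + c²(ρ_*−r)) − (q̂²/(ρ_*+r) + c²(ρ_*+r)) = λq̂. In particular, if λ = 0 then q̂ = (q₀+q₁)/2 + (η(U₀)−η(U₁))/(2A), and if q₀ = q₁ and η(U₀) − η(U₁) = λq₀ then q̂ = q₀ = q₁. -/
open Real Set

/-- The Rusanov flux-balance equation at an interface, written out as the balance of mass and the
balance of momentum. -/
theorem rus_balance_iff (c A : ℝ) (U0 U1 Um Up : ℝ × ℝ) :
    rus c A U0 Um - flux c Um + flux c Up - rus c A Up U1 = 0 ↔
      A * (Um.1 + Up.1) = A * (U0.1 + U1.1) + (U0.2 - U1.2) - (Um.2 - Up.2) ∧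
      A * (Um.2 + Up.2) + (eta c Um - eta c Up) =
        A * (U0.2 + U1.2) + eta c U0 - eta c U1 := by
  simp only [Prod.ext_iff, rus, flux, eta, Prod.fst_sub, Prod.fst_add, Prod.snd_sub, Prod.snd_add,
    Prod.smul_fst, Prod.smul_snd, Prod.fst_zero, Prod.snd_zero, smul_eq_mul]
  constructor <;> rintro ⟨hmass, hmom⟩ <;> constructor <;> linarith

/-- characterization of the solutions of the interface system for
`𝒢̃_λ` with the Rusanov flux: the common momentum is `q̂`, the densities average to
`ρ_*`, and the half-difference `r` solves the cubic equation. -/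
theorem stmt13 (c lam A : ℝ) (hc : 0 < c) (hlam : 0 ≤ lam) (hA : 0 < A)
    (U0 U1 : ℝ × ℝ) (hU0 : U0 ∈ Omega) (hU1 : U1 ∈ Omega)
    (ρs qhat : ℝ)
    (hρs : ρs = (U0.1 + U1.1) / 2 + (U0.2 - U1.2) / (2 * A)) (hρpos : 0 < ρs)
    (hqhat : qhat = (A * (U0.2 + U1.2) + eta c U0 - eta c U1) / (lam + 2 * A)) :
    (∀ Um Up : ℝ × ℝ, Um ∈ Omega → Up ∈ Omega →
      ((Um.2 = Up.2 ∧ eta c Um - eta c Up = lam * Um.2 ∧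
        rus c A U0 Um - flux c Um + flux c Up - rus c A Up U1 = 0) ↔
       (Um.2 = qhat ∧ Up.2 = qhat ∧ Um.1 + Up.1 = 2 * ρs ∧
        (Up.1 - Um.1) / 2 ∈ Set.Ioo (-ρs) ρs ∧
        (qhat ^ 2 / (ρs - (Up.1 - Um.1) / 2) + c ^ 2 * (ρs - (Up.1 - Um.1) / 2)) -
          (qhat ^ 2 / (ρs + (Up.1 - Um.1) / 2) + c ^ 2 * (ρs + (Up.1 - Um.1) / 2)) =
          lam * qhat))) ∧
    (lam = 0 → qhat = (U0.2 + U1.2) / 2 + (eta c U0 - eta c U1) / (2 * A)) ∧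
    ((U0.2 = U1.2 ∧ eta c U0 - eta c U1 = lam * U0.2) → qhat = U0.2 ∧ qhat = U1.2) := by
  have hden : lam + 2 * A ≠ 0 := by positivity
  have hρs' : 2 * A * ρs = A * (U0.1 + U1.1) + (U0.2 - U1.2) := by
    rw [hρs]
    field_simp
  have hqhat' : qhat * (lam + 2 * A) = A * (U0.2 + U1.2) + eta c U0 - eta c U1 := by
    rw [hqhat, div_mul_cancel₀ _ hden]
  refine ⟨fun Um Up hUm hUp => ?_, fun h => ?_, fun ⟨h, h'⟩ => ?_⟩
  · have hm : 0 < Um.1 := hUm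
    have hp : 0 < Up.1 := hUp
    rw [rus_balance_iff]
    constructor
    · rintro ⟨hq, hη, hmass, hmom⟩
      have hmq : Um.2 = qhat :=
        mul_right_cancel₀ hden (by rw [← hq] at hmom; linarith)
      have hpq : Up.2 = qhat := hq ▸ hmq
      have hsum : Um.1 + Up.1 = 2 * ρs :=
        mul_left_cancel₀ hA.ne' (by rw [← hq] at hmass; linarith)
      refine ⟨hmq, hpq, hsum, ⟨by linarith, by linarith⟩, ?_⟩
      rw [show ρs - (Up.1 - Um.1) / 2 = Um.1 by linarith,
        show ρs + (Up.1 - Um.1) / 2 = Up.1 by linarith]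
      simpa only [eta, hmq, hpq] using hη
    · rintro ⟨hmq, hpq, hsum, -, hr⟩
      rw [show ρs - (Up.1 - Um.1) / 2 = Um.1 by linarith,
        show ρs + (Up.1 - Um.1) / 2 = Up.1 by linarith] at hr
      have hη : eta c Um - eta c Up = lam * qhat := by
        simpa only [eta, hmq, hpq] using hr
      refine ⟨hmq.trans hpq.symm, by rw [hmq, hη], ?_, ?_⟩
      · rw [hmq, hpq, hsum]
        linarith
      · rw [hmq, hpq]
        linarith
  · rw [hqhat, h]
    field_simp
    ring
  · have h0 : qhat = U0.2 := mul_right_cancel₀ hden (by rw [← h] at hqhat'; linarith)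
    exact ⟨h0, h0.trans h⟩
end

section
/- Let ε > 0, λ ≥ 0, μ ≥ 0, γ > 1, ρ₀ > 0 and s_P ≥ 0. Let H : ℝ → ℝ be C¹ on [−ε,ε], nondecreasing, with H(−ε) = 0 and H(ε) = 1. Let ρ, u, e : ℝ → ℝ be C¹ on [−ε,ε] with ρ > 0 and e > 0 on [−ε,ε], and set p = (γ−1)ρe and E = ½ρu² + ρe. Assume that for every x ∈ [−ε,ε]: (ρu)'(x) = 0, (ρu² + p)'(x) = −λρ(x)u(x)H'(x), and (u(E+p))'(x) = −λρ(x)u(x)²H'(x) − μ(e(x) − s_P(ρ(x)/ρ₀)^{γ−1})H'(x). Define s(x) = e(x)·(ρ(x)/ρ₀)^{1−γ} and q = ρ(−ε)u(−ε). If q ≠ 0, then s(ε) − s_P = exp(−μ/q)·(s(−ε) − s_P). -/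
open Real Set

/-- across the regularized particle with heat exchange, the specific
entropy satisfies `s(ε) − s_P = exp(−μ/q)(s(−ε) − s_P)`. -/
theorem stmt15 (ε lam mu γ ρ0 sP : ℝ) (hε : 0 < ε) (hlam : 0 ≤ lam) (hmu : 0 ≤ mu)
    (hγ : 1 < γ) (hρ0 : 0 < ρ0) (hsP : 0 ≤ sP)
    (H ρ u e : ℝ → ℝ)
    (hH : ContDiffOn ℝ 1 H (Set.Icc (-ε) ε))
    (hHmono : MonotoneOn H (Set.Icc (-ε) ε))
    (hH0 : H (-ε) = 0) (hH1 : H ε = 1)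
    (hρ : ContDiffOn ℝ 1 ρ (Set.Icc (-ε) ε))
    (hu : ContDiffOn ℝ 1 u (Set.Icc (-ε) ε))
    (he : ContDiffOn ℝ 1 e (Set.Icc (-ε) ε))
    (hρpos : ∀ x ∈ Set.Icc (-ε) ε, 0 < ρ x)
    (hepos : ∀ x ∈ Set.Icc (-ε) ε, 0 < e x)
    (p Etot : ℝ → ℝ)
    (hpdef : p = fun x => (γ - 1) * ρ x * e x)
    (hEdef : Etot = fun x => (1 / 2) * ρ x * u x ^ 2 + ρ x * e x)
    (hmass : ∀ x ∈ Set.Icc (-ε) ε,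
      derivWithin (fun y => ρ y * u y) (Set.Icc (-ε) ε) x = 0)
    (hmom : ∀ x ∈ Set.Icc (-ε) ε,
      derivWithin (fun y => ρ y * u y ^ 2 + p y) (Set.Icc (-ε) ε) x =
        -lam * ρ x * u x * derivWithin H (Set.Icc (-ε) ε) x)
    (hener : ∀ x ∈ Set.Icc (-ε) ε,
      derivWithin (fun y => u y * (Etot y + p y)) (Set.Icc (-ε) ε) x =
        -lam * ρ x * u x ^ 2 * derivWithin H (Set.Icc (-ε) ε) x -
          mu * (e x - sP * (ρ x / ρ0) ^ (γ - 1)) * derivWithin H (Set.Icc (-ε) ε) x)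
    (s : ℝ → ℝ) (hs : s = fun x => e x * (ρ x / ρ0) ^ (1 - γ))
    (q : ℝ) (hqdef : q = ρ (-ε) * u (-ε)) (hq : q ≠ 0) :
    s ε - sP = Real.exp (-mu / q) * (s (-ε) - sP) := by
  set I := Set.Icc (-ε) ε with hI
  have hlt : -ε < ε := by linarith
  have hUD : UniqueDiffOn ℝ I := uniqueDiffOn_Icc hlt
  have hright : ε ∈ I := Set.right_mem_Icc.mpr hlt.le
  have hasDeriv : ∀ f : ℝ → ℝ, ContDiffOn ℝ 1 f I → ∀ x ∈ I,
      HasDerivWithinAt f (derivWithin f I x) I x := fun f hf x hx =>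
    (hf.differentiableOn one_ne_zero x hx).hasDerivWithinAt
  have hflux : ∀ x ∈ I, ρ x * u x = q := by
    intro x hx
    rw [hqdef]
    exact constant_of_derivWithin_zero
      ((hρ.mul hu).differentiableOn one_ne_zero)
      (fun y hy => hmass y (Set.Ico_subset_Icc_self hy)) x hx
  have hweighted : ∀ x ∈ I,
      HasDerivWithinAt (fun y => (s y - sP) * Real.exp (mu / q * H y)) 0 I x := by
    intro x hx
    have dρ := hasDeriv ρ hρ x hx
    have du := hasDeriv u hu x hx
    have de := hasDeriv e he x hx
    have dH := hasDeriv H hH x hx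
    have hρx := hρpos x hx
    have hq' := hflux x hx
    have dp := (dρ.const_mul (γ - 1)).mul de
    have dE :=
      ((dρ.const_mul (1 / 2)).mul (du.pow 2)).add (dρ.mul de)
    rw [← show p = (fun y => (γ - 1) * ρ y) * e from hpdef] at dp
    rw [← show Etot = (fun y => 1 / 2 * ρ y) * u ^ 2 + ρ * e from hEdef] at dE
    have mass := ((dρ.mul du).derivWithin (hUD x hx)).symm.trans (hmass x hx)
    have mom := (((dρ.mul (du.pow 2)).add dp).derivWithin (hUD x hx)).symm.trans (hmom x hx)
    have ener := ((du.mul (dE.add dp)).derivWithin (hUD x hx)).symm.trans (hener x hx)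
    have hpos : 0 < ρ x / ρ0 := div_pos hρx hρ0
    have ds :=
      de.mul ((dρ.div_const ρ0).rpow_const (p := 1 - γ) (Or.inl hpos.ne'))
    rw [← show s = e * fun y => (ρ y / ρ0) ^ (1 - γ) from hs] at ds
    have dF := (ds.sub_const sP).mul ((dH.const_mul (mu / q)).exp)
    refine dF.congr_deriv ?_
    have hsx : s x = e x * (ρ x / ρ0) ^ (1 - γ) := by rw [hs]
    have hpx : p x = (γ - 1) * ρ x * e x := by rw [hpdef]
    have hEx : Etot x = (1 / 2) * ρ x * u x ^ 2 + ρ x * e x := by rw [hEdef]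
    have hinv : (ρ x / ρ0) ^ (1 - γ) * (ρ x / ρ0) ^ (γ - 1) = 1 := by
      rw [← Real.rpow_add hpos]; simp
    have hpred : (ρ x / ρ0) ^ (1 - γ - 1) = (ρ x / ρ0) ^ (1 - γ) * (ρ0 / ρ x) := by
      rw [Real.rpow_sub_one hpos.ne', div_div_eq_mul_div, mul_div_assoc]
    simp only [Pi.add_apply, Pi.pow_apply, hpx, hEx] at mass mom ener
    rw [hsx, hpred]
    generalize (ρ x / ρ0) ^ (1 - γ) = a at *
    generalize (ρ x / ρ0) ^ (γ - 1) = b at *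
    generalize derivWithin ρ I x = r at *
    generalize derivWithin u I x = v at *
    generalize derivWithin e I x = w at *
    generalize derivWithin H I x = h at *
    have key : ρ x * u x * w - (γ - 1) * u x * r * e x = -mu * (e x - sP * b) * h := by
      push_cast at mom ener
      linear_combination ener - u x * mom + (u x ^ 2 / 2 - γ * e x) * mass
    have hu' : u x = q / ρ x := by field_simp; linarith
    rw [hu'] at key
    generalize Real.exp (mu / q * H x) = E
    field_simp at key ⊢
    linear_combination a * E * key + ρ x * mu * h * sP * E * hinv
  have hconst := constant_of_derivWithin_zero
    (fun x hx => (hweighted x hx).differentiableWithinAt)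
    (fun x hx => (hweighted x (Set.Ico_subset_Icc_self hx)).derivWithin
      (hUD x (Set.Ico_subset_Icc_self hx))) ε hright
  simp only [hH0, hH1, mul_one, mul_zero, Real.exp_zero] at hconst
  rw [← hconst, mul_left_comm, ← Real.exp_add, neg_div, neg_add_cancel, Real.exp_zero, mul_one]
end
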